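/- Let 𝒵 be a set, (𝒴,d) a metric space, and (𝒳,F,h) a state-space system with the echo state property whose filter U^F_h has the input forgetting property. Let ∼_I be the Nerode equivalence on 𝒵^{ℤ₋} associated to the functional H of U^F_h (z₁ ∼_I z₂ iff H^F_h(z₁ z̃) = H^F_h(z₂ z̃) for every finite word z̃), let 𝒳_R be the set of reachable states and ∼_S the Nerode relation on 𝒳_R. Then the map f : 𝒵^{ℤ₋}/∼_I → 𝒳_R/∼_S given by f([z]_{∼_I}) := [H^F(z)]_{∼_S} is well defined and a bijection between the two quotient spaces. -/

import Mathlib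

open Filter Topology

/-!
Semi-infinite sequences `z : ℤ₋ → α` are encoded as `ℕ → α` via `n ↦ z_{-n}`.
-/

/-- Concatenation `z z̃` of `z ∈ α^{ℤ₋}` with a finite word `z̃ = (z̃_1, …, z̃_T)`. -/
def concat {α : Type*} (z : ℕ → α) {T : ℕ} (w : Fin T → α) : ℕ → α := fun n =>
  if h : n < T then w ⟨T - 1 - n, by omega⟩ else z (n - T)

/-- `x` is a solution of the state system with state map `F` for the input `z`. -/
def IsSolution {X Z : Type*} (F : X → Z → X) (z : ℕ → Z) (x : ℕ → X) : Prop :=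
  ∀ n : ℕ, x n = F (x (n + 1)) (z n)

/-- Echo state property: every input has exactly one solution. -/
def ESP {X Z : Type*} (F : X → Z → X) : Prop :=
  ∀ z : ℕ → Z, ∃! x : ℕ → X, IsSolution F z x

/-- A filter `U` is causal: outputs at time `-n` only depend on inputs at times `≤ -n`. -/
def Causal {Z Y : Type*} (U : (ℕ → Z) → ℕ → Y) : Prop :=
  ∀ (z w : ℕ → Z) (n : ℕ), (∀ m : ℕ, n ≤ m → z m = w m) → U z n = U w n

/-- A filter `U` is time-invariant: it commutes with the time delays `T_τ`. -/
def TimeInvariant {Z Y : Type*} (U : (ℕ → Z) → ℕ → Y) : Prop :=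
  ∀ (τ : ℕ) (z : ℕ → Z) (n : ℕ), U (fun m => z (m + τ)) n = U z (n + τ)

/-- Input forgetting property of a filter `U` with values in a metric space:
the effect of two different pasts `u`, `v` washes out along any future `z`. -/
def IFP {Z Y : Type*} [PseudoMetricSpace Y] (U : (ℕ → Z) → ℕ → Y) : Prop :=
  ∀ (u v : ℕ → Z) (z : ℕ → Z),
    Tendsto (fun t : ℕ =>
        dist (U (concat u (fun i : Fin t => z i)) 0) (U (concat v (fun i : Fin t => z i)) 0))
      atTop (𝓝 0)

/-- The set `𝒳_R` of reachable states of a system with solution map `U`. -/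
def reachSet {X Z : Type*} (U : (ℕ → Z) → ℕ → X) : Set X := {x | ∃ z : ℕ → Z, U z 0 = x}

/-- The Nerode relation at the level of inputs: the outputs `H^F_h` after any common
finite continuation agree. -/
def nerodeS {X Z Y : Type*} (h : X → Y) (U : (ℕ → Z) → ℕ → X) (z₁ z₂ : ℕ → Z) : Prop :=
  ∀ (T : ℕ) (w : Fin T → Z), h (U (concat z₁ w) 0) = h (U (concat z₂ w) 0)

/-- The Nerode relation `∼_S` on the set of reachable states. -/
def stateRel {X Z Y : Type*} (h : X → Y) (U : (ℕ → Z) → ℕ → X)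
    (x₁ x₂ : reachSet U) : Prop :=
  ∀ z₁ z₂ : ℕ → Z, U z₁ 0 = (x₁ : X) → U z₂ 0 = (x₂ : X) → nerodeS h U z₁ z₂
/-- The Nerode equivalence on `Z^{ℤ₋}` associated to the functional `H_U (·) = U (·) 0`:
`z₁ ∼_I z₂` iff `H_U (z₁ z̃) = H_U (z₂ z̃)` for every finite word `z̃`. -/
def nerodeSetoid {Z Y : Type*} (U : (ℕ → Z) → ℕ → Y) : Setoid (ℕ → Z) where
  r z₁ z₂ := ∀ (T : ℕ) (w : Fin T → Z), U (concat z₁ w) 0 = U (concat z₂ w) 0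
  iseqv := ⟨fun _ _ _ => rfl, fun h T w => (h T w).symm, fun h h' T w => (h T w).trans (h' T w)⟩

theorem concat_add {α : Type*} (z : ℕ → α) {T : ℕ} (w : Fin T → α) (n : ℕ) :
    concat z w (n + T) = z n := by
  simp [concat]

theorem concat_eq_of_lt {α : Type*} (z₁ z₂ : ℕ → α) {T : ℕ} (w : Fin T → α) {n : ℕ}
    (hn : n < T) : concat z₁ w n = concat z₂ w n := by
  simp [concat, hn]

/-- Under the echo state property, appending a word shifts the solution. -/
theorem ESP.solution_concat_add {X Z : Type*} {F : X → Z → X} (hE : ESP F)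
    {U : (ℕ → Z) → ℕ → X} (hU : ∀ z, IsSolution F z (U z)) (z : ℕ → Z) {T : ℕ}
    (w : Fin T → Z) (n : ℕ) : U (concat z w) (n + T) = U z n := by
  have hs : IsSolution F z (fun n => U (concat z w) (n + T)) := fun n => by
    have := hU (concat z w) (n + T)
    rwa [concat_add, Nat.add_right_comm] at this
  exact congrFun ((hE z).unique hs (hU z)) n

/-- Under the echo state property, inputs reaching the same state keep doing so after
any common continuation. -/
theorem ESP.solution_concat_congr {X Z : Type*} {F : X → Z → X} (hE : ESP F)
    {U : (ℕ → Z) → ℕ → X} (hU : ∀ z, IsSolution F z (U z)) {z₁ z₂ : ℕ → Z}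
    (hz : U z₁ 0 = U z₂ 0) {T : ℕ} (w : Fin T → Z) :
    U (concat z₁ w) 0 = U (concat z₂ w) 0 := by
  have key : ∀ k ≤ T, U (concat z₁ w) (T - k) = U (concat z₂ w) (T - k) := by
    intro k
    induction k with
    | zero =>
      intro _
      have h₁ := hE.solution_concat_add hU z₁ w 0
      have h₂ := hE.solution_concat_add hU z₂ w 0
      rw [Nat.zero_add] at h₁ h₂
      rw [Nat.sub_zero, h₁, h₂, hz]
    | succ k ih =>
      intro hk
      rw [hU (concat z₁ w), hU (concat z₂ w), show T - (k + 1) + 1 = T - k by omega,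
        ih (by omega), concat_eq_of_lt z₁ z₂ w (by omega : T - (k + 1) < T)]
  simpa using key T le_rfl

/-- Under the echo state property, the Nerode relation on reachable states can be tested
on any choice of inputs reaching them. -/
theorem ESP.stateRel_iff {X Z Y : Type*} {F : X → Z → X} (hE : ESP F) (h : X → Y)
    {U : (ℕ → Z) → ℕ → X} (hU : ∀ z, IsSolution F z (U z)) (z₁ z₂ : ℕ → Z) :
    stateRel h U ⟨U z₁ 0, z₁, rfl⟩ ⟨U z₂ 0, z₂, rfl⟩ ↔ nerodeS h U z₁ z₂ := by
  refine ⟨fun hr => hr z₁ z₂ rfl rfl, fun hn u₁ u₂ h₁ h₂ T w => ?_⟩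
  rw [hE.solution_concat_congr hU h₁ w, hE.solution_concat_congr hU h₂ w]
  exact hn T w

theorem ESP.stateRel_equivalence {X Z Y : Type*} {F : X → Z → X} (hE : ESP F) (h : X → Y)
    {U : (ℕ → Z) → ℕ → X} (hU : ∀ z, IsSolution F z (U z)) : Equivalence (stateRel h U) where
  refl := by
    rintro ⟨_, z, rfl⟩
    exact (hE.stateRel_iff h hU z z).2 fun _ _ => rfl
  symm hr u₁ u₂ h₁ h₂ T w := (hr u₂ u₁ h₂ h₁ T w).symm
  trans := by
    rintro _ ⟨_, z, rfl⟩ _ hr hr' u₁ u₂ h₁ h₂ T w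
    exact (hr u₁ z h₁ rfl T w).trans (hr' z u₂ rfl h₂ T w)

/-- for a system with the ESP whose filter `U^F_h` has the input forgetting
property, the map `[z]_{∼_I} ↦ [H^F z]_{∼_S}` is a well-defined bijection between the
Nerode quotient of the input space and the reduced state space `𝒳_R/∼_S`. -/
theorem stmt10 {X Z Y : Type*} [MetricSpace Y] (F : X → Z → X) (h : X → Y)
    (hE : ESP F) (U : (ℕ → Z) → ℕ → X) (hU : ∀ z : ℕ → Z, IsSolution F z (U z))
    (hifp : IFP (fun z n => h (U z n))) :
    ∃ f : Quotient (nerodeSetoid (fun z n => h (U z n))) → Quot (stateRel h U),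
      (∀ z : ℕ → Z,
        f (Quotient.mk (nerodeSetoid (fun z n => h (U z n))) z)
          = Quot.mk (stateRel h U) ⟨U z 0, z, rfl⟩) ∧
      Function.Bijective f := by
  refine ⟨Quotient.lift (fun z => Quot.mk (stateRel h U) ⟨U z 0, z, rfl⟩)
    fun z₁ z₂ hz => Quot.sound ((hE.stateRel_iff h hU z₁ z₂).2 hz), fun _ => rfl, ?_, ?_⟩
  · rintro ⟨z₁⟩ ⟨z₂⟩ hz
    have hr := (hE.stateRel_equivalence h hU).eqvGen_iff.1 (Quot.eqvGen_exact hz)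
    exact Quotient.sound ((hE.stateRel_iff h hU z₁ z₂).1 hr)
  · rintro ⟨_, z, rfl⟩
    exact ⟨Quotient.mk _ z, rfl⟩
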